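/- Let (R,T) be an étale equivalence relation on a compact, metrizable, zero-dimensional space X, let G be a countable discrete group, and let α : G → Homeo(X) be an action of G by homeomorphisms on X such that: (i) (α_g × α_g)(R) = R for all g ∈ G; (ii) α_g × α_g : R → R is a homeomorphism for all g ∈ G; (iii) (x, α_g(x)) ∉ R for every x ∈ X and every g ≠ e in G (in particular the action is free). Then the equivalence relation R_G = {(x, α_g(x)) : x ∈ X, g ∈ G}, with the topology transferred from X × G via (x,g) ↦ (x, α_g(x)), is an étale equivalence relation on X which is transverse to R, a transversality homeomorphism being h : R×_X R_G → R_G×_X R given by h((x,y),(y,α_g(y))) = ((x,α_g(x)),(α_g(x),α_g(y))) for all (x,y) ∈ R and g ∈ G. -/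

import Mathlib

open Set Topology MeasureTheory

universe u v

/-! ### Basic notions: étale equivalence relations -/

/-- The set of composable pairs of an equivalence relation `R ⊆ X × X`. -/
def CompPairs {X : Type u} (R : Set (X × X)) : Set (↥R × ↥R) :=
  {q | (q.1 : X × X).2 = (q.2 : X × X).1}

/-- The topology on the set of composable pairs obtained from a topology `T` on `R`. -/
def compPairsTop {X : Type u} (R : Set (X × X)) (T : TopologicalSpace ↥R) :
    TopologicalSpace ↥(CompPairs R) :=
  letI := T; inferInstance

/-- The composition (product) map of the groupoid `R`. -/
def compMap {X : Type u} (R : Set (X × X))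
    (htrans : ∀ ⦃x y z : X⦄, (x, y) ∈ R → (y, z) ∈ R → (x, z) ∈ R) :
    ↥(CompPairs R) → ↥R := fun q =>
  ⟨((q.1.1 : X × X).1, (q.1.2 : X × X).2),
    htrans q.1.1.2 (by
      rw [show ((q.1.1 : X × X)).2 = ((q.1.2 : X × X)).1 from q.2]
      exact q.1.2.2)⟩

/-- The inverse map of the groupoid `R`. -/
def invMap {X : Type u} (R : Set (X × X))
    (hsymm : ∀ ⦃x y : X⦄, (x, y) ∈ R → (y, x) ∈ R) : ↥R → ↥R := fun p =>
  ⟨((p : X × X).2, (p : X × X).1), hsymm p.2⟩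

/-- `(R, T)` is an étale equivalence relation on `X`: a countable equivalence relation
equipped with a Hausdorff, locally compact, second countable topology `T` such that
composition of composable pairs is continuous, inversion is a homeomorphism, and the
range map `r(x,y) = x` is a local homeomorphism. -/
structure IsEtaleEquivRel {X : Type u} [TopologicalSpace X] (R : Set (X × X))
    (T : TopologicalSpace ↥R) : Prop where
  refl : ∀ x : X, (x, x) ∈ R
  symm : ∀ ⦃x y : X⦄, (x, y) ∈ R → (y, x) ∈ R
  trans : ∀ ⦃x y z : X⦄, (x, y) ∈ R → (y, z) ∈ R → (x, z) ∈ R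
  countable : ∀ x : X, {y | (x, y) ∈ R}.Countable
  t2 : @T2Space ↥R T
  locallyCompact : @LocallyCompactSpace ↥R T
  secondCountable : @SecondCountableTopology ↥R T
  continuous_comp : @Continuous _ _ (compPairsTop R T) T (compMap R trans)
  homeo_inv : @IsHomeomorph _ _ T T (invMap R symm)
  localHomeo_range : @IsLocalHomeomorph ↥R X T inferInstance fun p => (p : X × X).1

/-- A CEER: compact étale equivalence relation. -/
def IsCEER {X : Type u} [TopologicalSpace X] (R : Set (X × X))
    (T : TopologicalSpace ↥R) : Prop :=
  IsEtaleEquivRel R T ∧ @CompactSpace ↥R T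

/-- `R ⊆ X × X` is an equivalence relation. -/
def IsEquivRel {X : Type u} (R : Set (X × X)) : Prop :=
  (∀ x : X, (x, x) ∈ R) ∧ (∀ ⦃x y : X⦄, (x, y) ∈ R → (y, x) ∈ R) ∧
    (∀ ⦃x y z : X⦄, (x, y) ∈ R → (y, z) ∈ R → (x, z) ∈ R)

/-- The relative topology on `R ⊆ X × X` inherited from the product topology. -/
def relTop {X : Type u} [TopologicalSpace X] (R : Set (X × X)) : TopologicalSpace ↥R :=
  inferInstance

/-- Given a topology `T` on `R` and any `U ⊆ X × X` (intended: `U ⊆ R`), the relative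
topology on `U` induced from `(R, T)`. -/
def relSubTop {X : Type u} [TopologicalSpace X] {R : Set (X × X)}
    (T : TopologicalSpace ↥R) (U : Set (X × X)) : TopologicalSpace ↥U :=
  TopologicalSpace.induced Subtype.val
    (TopologicalSpace.coinduced (Subtype.val : ↥R → X × X) T)

/-- An equivalence relation is minimal if all equivalence classes are dense. -/
def IsMinimalRel {X : Type u} [TopologicalSpace X] (R : Set (X × X)) : Prop :=
  ∀ x : X, Dense {y | (x, y) ∈ R}

/-- `F` implements an isomorphism between the étale equivalence relations
`(R₁, T₁)` on `X` and `(R₂, T₂)` on `Z`. -/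
def ImplementsIso {X : Type u} {Z : Type v} [TopologicalSpace X] [TopologicalSpace Z]
    (R₁ : Set (X × X)) (T₁ : TopologicalSpace ↥R₁)
    (R₂ : Set (Z × Z)) (T₂ : TopologicalSpace ↥R₂) (F : X → Z) : Prop :=
  IsHomeomorph F ∧ (∀ x y : X, (x, y) ∈ R₁ ↔ (F x, F y) ∈ R₂) ∧
    ∃ G : ↥R₁ → ↥R₂, (∀ p : ↥R₁, (G p : Z × Z) = (F (p : X × X).1, F (p : X × X).2)) ∧
      @IsHomeomorph _ _ T₁ T₂ G

/-! ### Graphs, invariant measures, thin sets -/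

/-- A (local) graph in `(R, T)`: a clopen subset on which both the range and source maps
are homeomorphisms onto clopen subsets of `X`. -/
def IsGraph {X : Type u} [TopologicalSpace X] (R : Set (X × X))
    (T : TopologicalSpace ↥R) (U : Set ↥R) : Prop :=
  letI := T
  IsClopen U ∧
    IsClopen ((fun p : ↥R => (p : X × X).1) '' U) ∧
    IsClopen ((fun p : ↥R => (p : X × X).2) '' U) ∧
    Topology.IsEmbedding (fun p : ↥U => ((p : ↥R) : X × X).1) ∧
    Topology.IsEmbedding (fun p : ↥U => ((p : ↥R) : X × X).2)

/-- A probability measure is `R`-invariant when `μ(A) = μ(B)` for every graph `(A, γ, B)`. -/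
def IsInvariantMeasure {X : Type u} [TopologicalSpace X] [MeasurableSpace X]
    (R : Set (X × X)) (T : TopologicalSpace ↥R) (μ : Measure X) : Prop :=
  ∀ U : Set ↥R, IsGraph R T U →
    μ ((fun p : ↥R => (p : X × X).1) '' U) = μ ((fun p : ↥R => (p : X × X).2) '' U)

/-- `Y` is `R`-thin: `μ Y = 0` for every `R`-invariant probability measure `μ`. -/
def IsThin {X : Type u} [TopologicalSpace X] [MeasurableSpace X]
    (R : Set (X × X)) (T : TopologicalSpace ↥R) (Y : Set X) : Prop :=
  ∀ μ : Measure X, IsProbabilityMeasure μ → IsInvariantMeasure R T μ → μ Y = 0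

/-! ### AF-equivalence relations -/

/-- The inductive limit topology on `R = ⋃ n, Rseq n`, each `Rseq n` carrying its
relative topology from `X × X`. -/
def inductiveLimitTop {X : Type u} [TopologicalSpace X] (R : Set (X × X))
    (Rseq : ℕ → Set (X × X)) (hsub : ∀ n, Rseq n ⊆ R) : TopologicalSpace ↥R :=
  ⨆ n, TopologicalSpace.coinduced
    (fun p : ↥(Rseq n) => (⟨(p : X × X), hsub n p.2⟩ : ↥R)) (relTop (Rseq n))

/-- `(R, T)` is an AF-equivalence relation: the inductive limit of an ascending sequence
of CEERs `Δ_X = R₀ ⊆ R₁ ⊆ R₂ ⊆ ⋯` with each `Rₙ` open in `Rₙ₊₁`, `T` being the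
inductive limit topology. -/
def IsAFEquivRel {X : Type u} [TopologicalSpace X] (R : Set (X × X))
    (T : TopologicalSpace ↥R) : Prop :=
  ∃ (Rseq : ℕ → Set (X × X)) (hsub : ∀ n, Rseq n ⊆ R),
    Rseq 0 = Set.diagonal X ∧
    (∀ n, Rseq n ⊆ Rseq (n + 1)) ∧
    (∀ n, IsCEER (Rseq n) (relTop (Rseq n))) ∧
    (∀ n, IsOpen[relTop (Rseq (n + 1))]
      ((Subtype.val : ↥(Rseq (n + 1)) → X × X) ⁻¹' Rseq n)) ∧
    (⋃ n, Rseq n) = R ∧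
    T = inductiveLimitTop R Rseq hsub

/-! ### Clopen partitions and groupoid partitions -/

/-- `U · V` for subsets `U, V ⊆ X × X`. -/
def SetComp {X : Type u} (U V : Set (X × X)) : Set (X × X) :=
  {p | ∃ y : X, (p.1, y) ∈ U ∧ (y, p.2) ∈ V}

/-- `U⁻¹` for a subset `U ⊆ X × X`. -/
def SetInv {X : Type u} (U : Set (X × X)) : Set (X × X) :=
  {p | (p.2, p.1) ∈ U}

/-- `P` is finer than `Q` if every element of `P` is contained in some element of `Q`. -/
def FinerThan {α : Type u} (P Q : Set (Set α)) : Prop :=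
  ∀ U ∈ P, ∃ V ∈ Q, U ⊆ V

/-- A finite clopen partition of `(R, T)` by subsets of `X × X`. -/
def IsClopenPartitionRel {X : Type u} [TopologicalSpace X] (R : Set (X × X))
    (T : TopologicalSpace ↥R) (P : Set (Set (X × X))) : Prop :=
  letI := T
  P.Finite ∧ (∀ U ∈ P, U ⊆ R ∧ U.Nonempty ∧ IsClopen ((Subtype.val : ↥R → X × X) ⁻¹' U)) ∧
    P.PairwiseDisjoint id ∧ ⋃₀ P = R

/-- A finite clopen partition of a topological space `Z`. -/
def IsClopenPartitionSpace (Z : Type u) [TopologicalSpace Z] (P : Set (Set Z)) : Prop :=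
  P.Finite ∧ (∀ U ∈ P, U.Nonempty ∧ IsClopen U) ∧ P.PairwiseDisjoint id ∧ ⋃₀ P = Set.univ

/-- A groupoid partition of the CEER `(R, T)`. -/
def IsGroupoidPartition {X : Type u} [TopologicalSpace X] (R : Set (X × X))
    (T : TopologicalSpace ↥R) (P : Set (Set (X × X))) : Prop :=
  IsClopenPartitionRel R T P ∧
    (∀ U ∈ P, U ⊆ Set.diagonal X ∨ U ⊆ R \ Set.diagonal X) ∧
    (∀ U ∈ P,
      @Topology.IsEmbedding ↥U X (relSubTop T U) _ (fun p => (p : X × X).1) ∧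
      @Topology.IsEmbedding ↥U X (relSubTop T U) _ (fun p => (p : X × X).2)) ∧
    (∀ U ∈ P, U ⊆ R \ Set.diagonal X → (Prod.fst '' U) ∩ (Prod.snd '' U) = ∅) ∧
    (∀ U ∈ P, ∀ V ∈ P, SetComp U V = ∅ ∨ SetComp U V ∈ P) ∧
    (∀ U ∈ P, SetInv U ∈ P)

/-- The trace on the diagonal of a partition of `R`, viewed as a family of subsets of `X`. -/
def diagTrace {X : Type u} (P : Set (Set (X × X))) : Set (Set X) :=
  {A | ∃ U ∈ P, U ⊆ Set.diagonal X ∧ A = Prod.fst '' U}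

/-! ### Restriction to a closed subset -/

/-- The restriction `R|_Y` of `R ⊆ X × X` to `Y ⊆ X`, as a relation on `↥Y`. -/
def restrictRel {X : Type u} (R : Set (X × X)) (Y : Set X) : Set (↥Y × ↥Y) :=
  {p | ((p.1 : X), (p.2 : X)) ∈ R}

/-- The relative topology on `R|_Y` induced from `(R, T)`. -/
def restrictTop {X : Type u} [TopologicalSpace X] (R : Set (X × X))
    (T : TopologicalSpace ↥R) (Y : Set X) : TopologicalSpace ↥(restrictRel R Y) :=
  TopologicalSpace.induced
    (fun p : ↥(restrictRel R Y) => (⟨((p.1.1 : X), (p.1.2 : X)), p.2⟩ : ↥R)) T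

/-! ### Fibred products, transversality, joins -/

/-- The fibred product `R ×_X S`. -/
abbrev Fib {X : Type u} (R S : Set (X × X)) : Type u :=
  {q : ↥R × ↥S // (q.1 : X × X).2 = (q.2 : X × X).1}

/-- The range map `r((x,y),(y,z)) = x` on `R ×_X S`. -/
def fibR {X : Type u} {R S : Set (X × X)} (q : Fib R S) : X := (q.1.1 : X × X).1

/-- The source map `s((x,y),(y,z)) = z` on `R ×_X S`. -/
def fibS {X : Type u} {R S : Set (X × X)} (q : Fib R S) : X := (q.1.2 : X × X).2

/-- The relative topology on `R ×_X S` from the product of `(R, T)` and `(S, T')`. -/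
def fibTop {X : Type u} {R S : Set (X × X)} (T : TopologicalSpace ↥R)
    (T' : TopologicalSpace ↥S) : TopologicalSpace (Fib R S) :=
  letI := T; letI := T'; inferInstance

/-- `(R, T)` and `(S, T')` are transverse: `R ∩ S = Δ_X` and there is a homeomorphism
`h : R ×_X S → S ×_X R` with `r ∘ h = r` and `s ∘ h = s`. -/
def AreTransverse {X : Type u} [TopologicalSpace X] (R : Set (X × X))
    (T : TopologicalSpace ↥R) (S : Set (X × X)) (T' : TopologicalSpace ↥S) : Prop :=
  R ∩ S = Set.diagonal X ∧
    ∃ h : Fib R S → Fib S R,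
      @IsHomeomorph _ _ (fibTop T T') (fibTop T' T) h ∧
      (∀ q, fibR (h q) = fibR q) ∧ (∀ q, fibS (h q) = fibS q)

/-- The equivalence relation `R ∨ S` generated by `R` and `S`. -/
def joinRel {X : Type u} (R S : Set (X × X)) : Set (X × X) :=
  {p | Relation.EqvGen (fun a b => (a, b) ∈ R ∨ (a, b) ∈ S) p.1 p.2}

/-- The map `r × s : R ×_X S → R ∨ S`. -/
def rsFun {X : Type u} (R S : Set (X × X)) : Fib R S → ↥(joinRel R S) := fun q =>
  ⟨(fibR q, fibS q), by
    have h1 : ((q.1.1 : X × X).1, (q.1.1 : X × X).2) ∈ R := q.1.1.2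
    have h2 : ((q.1.1 : X × X).2, (q.1.2 : X × X).2) ∈ S := by
      rw [show ((q.1.1 : X × X)).2 = ((q.1.2 : X × X)).1 from q.2]
      exact q.1.2.2
    exact Relation.EqvGen.trans _ _ _ (Relation.EqvGen.rel _ _ (Or.inl h1))
      (Relation.EqvGen.rel _ _ (Or.inr h2))⟩

/-- The topology on `R ∨ S` transferred from `R ×_X S` via the bijection `r × s`. -/
def joinTop {X : Type u} [TopologicalSpace X] (R S : Set (X × X))
    (T : TopologicalSpace ↥R) (T' : TopologicalSpace ↥S) :
    TopologicalSpace ↥(joinRel R S) :=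
  TopologicalSpace.coinduced (rsFun R S) (fibTop T T')

/-- The topology on an image `f '' s` transferred from a topology on `s` via `f`. -/
def imageTop {α : Type u} {β : Type v} (s : Set α) (Ts : TopologicalSpace ↥s)
    (f : α → β) : TopologicalSpace ↥(f '' s) :=
  TopologicalSpace.coinduced (fun p : ↥s => ⟨f p.1, ⟨p.1, p.2, rfl⟩⟩) Ts
/-! ### Bratteli diagrams -/

/-- A (standard) Bratteli diagram. `V n` is the (finite, nonempty) vertex set at level `n`
(`V 0` a singleton), and `E n` is the edge set connecting level `n` to level `n + 1`
(so `E n` plays the role of `E_{n+1}` in the paper), with source map `src n : E n → V n`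
and range map `rng n : E n → V (n+1)`, both surjective. -/
structure BratteliDiagram : Type 1 where
  V : ℕ → Type
  E : ℕ → Type
  fin_V : ∀ n, Finite (V n)
  fin_E : ∀ n, Finite (E n)
  nonempty_V : ∀ n, Nonempty (V n)
  nonempty_E : ∀ n, Nonempty (E n)
  subsingleton_V0 : Subsingleton (V 0)
  src : ∀ n, E n → V n
  rng : ∀ n, E n → V (n + 1)
  src_surj : ∀ n, Function.Surjective (src n)
  rng_surj : ∀ n, Function.Surjective (rng n)

namespace BratteliDiagram

/-- The path space `X_{(V,E)}` of a Bratteli diagram. -/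
abbrev pathSpace (B : BratteliDiagram) : Type :=
  {x : ∀ n, B.E n // ∀ n, B.rng n (x n) = B.src (n + 1) (x (n + 1))}

/-- The topology on the path space: the relative topology from `∏ n, E n`
with each `E n` discrete. -/
def pathTop (B : BratteliDiagram) : TopologicalSpace B.pathSpace :=
  letI : ∀ n, TopologicalSpace (B.E n) := fun _ => ⊥
  inferInstance

/-- `AF_n(V,E)`: cofinality from level `n` on. -/
def AFn (B : BratteliDiagram) (n : ℕ) : Set (B.pathSpace × B.pathSpace) :=
  {p | ∀ m, n ≤ m → p.1.1 m = p.2.1 m}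

/-- The relative topology on `AF_n(V,E)` from `X_{(V,E)} × X_{(V,E)}`. -/
def AFnTop (B : BratteliDiagram) (n : ℕ) : TopologicalSpace ↥(B.AFn n) :=
  letI := B.pathTop
  inferInstance

/-- The cofinality relation `AF(V,E) = ⋃ n, AF_n(V,E)`. -/
def AF (B : BratteliDiagram) : Set (B.pathSpace × B.pathSpace) :=
  ⋃ n, B.AFn n

/-- The inductive limit topology on `AF(V,E)`. -/
def AFTop (B : BratteliDiagram) : TopologicalSpace ↥B.AF :=
  ⨆ n, TopologicalSpace.coinduced
    (fun p : ↥(B.AFn n) => (⟨p.1, Set.mem_iUnion.mpr ⟨n, p.2⟩⟩ : ↥B.AF)) (B.AFnTop n)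

/-- A Bratteli diagram is simple if for every level `n` there is a later level such that
every vertex at level `n` is connected by a path of edges to every vertex at that level. -/
def IsSimple (B : BratteliDiagram) : Prop :=
  ∀ n : ℕ, ∃ k : ℕ, ∀ (v : B.V n) (w : B.V (n + k + 1)),
    ∃ es : ∀ j, B.E j, B.src n (es n) = v ∧ B.rng (n + k) (es (n + k)) = w ∧
      ∀ j, n ≤ j → j + 1 ≤ n + k → B.rng j (es j) = B.src (j + 1) (es (j + 1))

end BratteliDiagram

/-- `Fs` determines an (edge) Bratteli subdiagram of `B`. -/
def IsSubdiagram (B : BratteliDiagram) (Fs : ∀ n, Set (B.E n)) : Prop :=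
  (∀ n, (Fs n).Nonempty) ∧ ∀ n, B.src (n + 1) '' Fs (n + 1) = B.rng n '' Fs n

/-- Vertex sets of the subdiagram determined by `Fs`. -/
def subVertex (B : BratteliDiagram) (Fs : ∀ n, Set (B.E n)) : ℕ → Type
  | 0 => B.V 0
  | n + 1 => ↥(B.rng n '' Fs n)

/-- The Bratteli subdiagram of `B` determined by `Fs`, as a Bratteli diagram. -/
def subdiagramB (B : BratteliDiagram) (Fs : ∀ n, Set (B.E n))
    (h : IsSubdiagram B Fs) : BratteliDiagram where
  V := subVertex B Fs
  E n := ↥(Fs n)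
  fin_V n := by
    cases n with
    | zero => exact B.fin_V 0
    | succ m => haveI := B.fin_V (m + 1); exact inferInstanceAs (Finite ↥(B.rng m '' Fs m))
  fin_E n := by haveI := B.fin_E n; exact inferInstanceAs (Finite ↥(Fs n))
  nonempty_V n := by
    cases n with
    | zero => exact B.nonempty_V 0
    | succ m =>
      obtain ⟨e, he⟩ := h.1 m
      exact ⟨⟨B.rng m e, ⟨e, he, rfl⟩⟩⟩
  nonempty_E n := by obtain ⟨e, he⟩ := h.1 n; exact ⟨⟨e, he⟩⟩
  subsingleton_V0 := B.subsingleton_V0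
  src n := match n with
    | 0 => fun e => B.src 0 e.1
    | m + 1 => fun e =>
      ⟨B.src (m + 1) e.1, by rw [← h.2 m]; exact ⟨e.1, e.2, rfl⟩⟩
  rng n := fun e => ⟨B.rng n e.1, ⟨e.1, e.2, rfl⟩⟩
  src_surj n := by
    cases n with
    | zero =>
      intro v
      haveI : Subsingleton (subVertex B Fs 0) := B.subsingleton_V0
      obtain ⟨e, he⟩ := h.1 0
      exact ⟨⟨e, he⟩, Subsingleton.elim _ _⟩
    | succ m =>
      intro v
      obtain ⟨vv, hvv⟩ := v
      rw [← h.2 m] at hvv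
      obtain ⟨e, he, hev⟩ := hvv
      exact ⟨⟨e, he⟩, Subtype.ext hev⟩
  rng_surj n := by
    intro v
    obtain ⟨vv, hv⟩ := v
    obtain ⟨e, he, hev⟩ := hv
    exact ⟨⟨e, he⟩, Subtype.ext hev⟩

/-! ### Orbit equivalence relation of a group action -/

/-- The orbit equivalence relation `R_G = {(x, g•x)}` of a group action. -/
def orbitRelSet (G : Type v) (X : Type u) [Group G] [MulAction G X] : Set (X × X) :=
  {p | ∃ g : G, p.2 = g • p.1}

/-- The topology on `R_G` transferred from the product topology on `X × G`
(`G` discrete) via the bijection `(x, g) ↦ (x, g • x)`. -/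
def orbitRelTop (G : Type v) (X : Type u) [TopologicalSpace X] [Group G] [MulAction G X] :
    TopologicalSpace ↥(orbitRelSet G X) :=
  letI : TopologicalSpace G := ⊥
  TopologicalSpace.coinduced
    (fun q : X × G => (⟨(q.1, q.2 • q.1), ⟨q.2, rfl⟩⟩ : ↥(orbitRelSet G X))) inferInstance

/-- The product projection with discrete second factor is a local homeomorphism. -/
lemma isLocalHomeomorph_fst_discrete {X : Type u} {G : Type v} [TopologicalSpace X]
    [TopologicalSpace G] [DiscreteTopology G] :
    IsLocalHomeomorph (Prod.fst : X × G → X) := by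
  rw [isLocalHomeomorph_iff_isOpenEmbedding_restrict]
  rintro ⟨x, g⟩
  refine ⟨Prod.snd ⁻¹' {g}, ?_, ?_⟩
  · exact ((isOpen_discrete {g}).preimage continuous_snd).mem_nhds rfl
  · refine IsOpenEmbedding.of_continuous_injective_isOpenMap
      (continuous_fst.comp continuous_subtype_val) ?_ ?_
    · rintro ⟨⟨a, b⟩, hb⟩ ⟨⟨a', b'⟩, hb'⟩ h
      have h1 : a = a' := h
      have h2 : b = g := hb
      have h3 : b' = g := hb'
      subst h1 h2 h3
      rfl
    · exact isOpenMap_fst.comp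
        ((isOpen_discrete {g}).preimage continuous_snd).isOpenMap_subtype_val

/-- The bijection `(x, g) ↦ (x, g • x)` as a homeomorphism. -/
lemma exists_orbit_homeo {X : Type u} {G : Type v} [TopologicalSpace X] [Group G] [MulAction G X]
    (hf : ∀ (g : G) (x : X), g • x = x → g = 1) [TopologicalSpace G] [DiscreteTopology G] :
    ∃ e : @Homeomorph (X × G) ↥(orbitRelSet G X) _ (orbitRelTop G X),
      ∀ q : X × G, ((e q : ↥(orbitRelSet G X)) : X × X) = (q.1, q.2 • q.1) := by
  letI := orbitRelTop G X
  let f : X × G → ↥(orbitRelSet G X) := fun q => ⟨(q.1, q.2 • q.1), ⟨q.2, rfl⟩⟩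
  have hbij : Function.Bijective f := by
    constructor
    · rintro ⟨x, g⟩ ⟨x', g'⟩ h
      have h0 := congrArg Subtype.val h
      have h1 : x = x' := congrArg Prod.fst h0
      have h2 : g • x = g' • x' := congrArg Prod.snd h0
      subst h1
      have := hf (g'⁻¹ * g) x (by rw [mul_smul, h2, inv_smul_smul])
      rw [inv_mul_eq_one] at this
      rw [this]
    · rintro ⟨⟨x, y⟩, g, hg⟩
      refine ⟨(x, g), ?_⟩
      apply Subtype.ext
      simp only [f]
      exact Prod.ext rfl hg.symm
  have hq : IsQuotientMap f := by
    refine ⟨⟨?_⟩, hbij.2⟩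
    have : ‹TopologicalSpace G› = ⊥ := DiscreteTopology.eq_bot
    subst this
    rfl
  let e₀ := Equiv.ofBijective f hbij
  refine ⟨⟨e₀, hq.continuous, hq.continuous_iff.2 ?_⟩, fun q => rfl⟩
  have : e₀.symm ∘ f = id := funext fun q => e₀.symm_apply_apply q
  change Continuous (e₀.symm ∘ f)
  rw [this]
  exact continuous_id

/-- If a countable group `G` acts by homeomorphisms on `X`, leaving an
étale equivalence relation `(R, T)` invariant (each `α_g × α_g` a homeomorphism of `R`)
and with `(x, α_g x) ∉ R` for `g ≠ 1`, then `R_G = {(x, g•x)}` with the transferred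
topology is an étale equivalence relation transverse to `R`, a transversality
homeomorphism being `h((x,y),(y,g•y)) = ((x,g•x),(g•x,g•y))`. -/
theorem group_action_transverse {X : Type} [TopologicalSpace X] [CompactSpace X]
    [TopologicalSpace.MetrizableSpace X] [TotallyDisconnectedSpace X]
    (R : Set (X × X)) (T : TopologicalSpace ↥R) (hR : IsEtaleEquivRel R T)
    (G : Type) [Group G] [Countable G] [MulAction G X]
    (hcont : ∀ g : G, Continuous fun x : X => g • x)
    (hinv : ∀ (g : G) (x y : X), (x, y) ∈ R ↔ (g • x, g • y) ∈ R)
    (hhomeo : ∀ g : G, @IsHomeomorph ↥R ↥R T T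
      (fun p => ⟨(g • (p : X × X).1, g • (p : X × X).2), (hinv g _ _).mp p.2⟩))
    (hfree : ∀ (g : G) (x : X), g ≠ 1 → (x, g • x) ∉ R) :
    IsEtaleEquivRel (orbitRelSet G X) (orbitRelTop G X) ∧
    R ∩ orbitRelSet G X = Set.diagonal X ∧
    ∃ h : Fib R (orbitRelSet G X) → Fib (orbitRelSet G X) R,
      @IsHomeomorph _ _ (fibTop T (orbitRelTop G X)) (fibTop (orbitRelTop G X) T) h ∧
      (∀ q, fibR (h q) = fibR q) ∧ (∀ q, fibS (h q) = fibS q) ∧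
      ∀ (q : Fib R (orbitRelSet G X)) (g : G),
        (q.1.2 : X × X).2 = g • (q.1.2 : X × X).1 →
          ((h q).1.1 : X × X) = ((q.1.1 : X × X).1, g • (q.1.1 : X × X).1) ∧
          ((h q).1.2 : X × X) = (g • (q.1.1 : X × X).1, g • (q.1.1 : X × X).2) := by
  letI : TopologicalSpace G := ⊥
  haveI : DiscreteTopology G := ⟨rfl⟩
  have hf : ∀ (g : G) (x : X), g • x = x → g = 1 := by
    intro g x h
    by_contra hg
    exact hfree g x hg (by rw [h]; exact hR.refl x)
  letI := T
  letI TS := orbitRelTop G X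
  haveI := hR.t2
  obtain ⟨e, he⟩ := exists_orbit_homeo (X := X) (G := G) hf
  -- the cocycle
  let c : ↥(orbitRelSet G X) → G := fun p => (e.symm p).2
  have hc : Continuous c := continuous_snd.comp e.symm.continuous
  have hfst : ∀ p : ↥(orbitRelSet G X), (e.symm p).1 = p.1.1 := by
    intro p
    have := he (e.symm p)
    rw [e.apply_symm_apply] at this
    rw [this]
  have hsnd : ∀ p : ↥(orbitRelSet G X), p.1.2 = c p • p.1.1 := by
    intro p
    have := he (e.symm p)
    rw [e.apply_symm_apply] at this
    rw [this]
  have cuniq : ∀ (p : ↥(orbitRelSet G X)) (g : G), p.1.2 = g • p.1.1 → c p = g := by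
    intro p g h
    rw [hsnd p] at h
    have := hf (g⁻¹ * c p) p.1.1 (by rw [mul_smul, h, inv_smul_smul])
    rw [inv_mul_eq_one] at this
    exact this.symm
  have hSfst : Continuous (fun p : ↥(orbitRelSet G X) => p.1.1) := by
    have : (fun p : ↥(orbitRelSet G X) => p.1.1) = fun p => (e.symm p).1 :=
      funext fun p => (hfst p).symm
    rw [this]
    exact continuous_fst.comp e.symm.continuous
  have hact : Continuous (fun q : X × G => q.2 • q.1) :=
    continuous_prod_of_discrete_right.2 fun g => hcont g
  have hSsnd : Continuous (fun p : ↥(orbitRelSet G X) => p.1.2) := by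
    have : (fun p : ↥(orbitRelSet G X) => p.1.2) = fun p => c p • p.1.1 := funext hsnd
    rw [this]
    exact hact.comp (hSfst.prodMk hc)
  have ecs : ∀ p : ↥(orbitRelSet G X), e (p.1.1, c p) = p := by
    intro p
    rw [← hfst p]
    exact e.apply_symm_apply p
  have hRfst : Continuous (fun p : ↥R => p.1.1) := hR.localHomeo_range.continuous
  have hRsnd : Continuous (fun p : ↥R => p.1.2) := hRfst.comp hR.homeo_inv.continuous
  have hactR : Continuous (fun q : ↥R × G =>
      (⟨(q.2 • q.1.1.1, q.2 • q.1.1.2), (hinv q.2 _ _).mp q.1.2⟩ : ↥R)) :=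
    continuous_prod_of_discrete_right.2 fun g => (hhomeo g).continuous
  have srefl : ∀ x : X, (x, x) ∈ orbitRelSet G X := fun x => ⟨1, (one_smul G x).symm⟩
  have ssymm : ∀ ⦃x y : X⦄, (x, y) ∈ orbitRelSet G X → (y, x) ∈ orbitRelSet G X := by
    rintro x y ⟨g, hg⟩
    exact ⟨g⁻¹, eq_inv_smul_iff.2 hg.symm⟩
  have strans : ∀ ⦃x y z : X⦄, (x, y) ∈ orbitRelSet G X → (y, z) ∈ orbitRelSet G X →
      (x, z) ∈ orbitRelSet G X := by
    rintro x y z ⟨g, hg⟩ ⟨k, hk⟩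
    refine ⟨k * g, ?_⟩
    dsimp only at hg hk ⊢
    rw [hk, hg, mul_smul]
  have hmk : ∀ {Z : Type} [TopologicalSpace Z] (f : Z → ↥(orbitRelSet G X)) (k : Z → G),
      Continuous (fun z => (f z).1.1) → Continuous k →
      (∀ z, (f z).1.2 = k z • (f z).1.1) → Continuous f := by
    intro Z _ f k h1 h2 h3
    have : f = fun z => e ((f z).1.1, k z) := by
      funext z
      rw [← cuniq (f z) (k z) (h3 z), ecs]
    rw [this]
    exact e.continuous.comp (h1.prodMk h2)
  have hinvc : Continuous (invMap (orbitRelSet G X) ssymm) :=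
    hmk _ (fun p => (c p)⁻¹) hSsnd (continuous_of_discreteTopology.comp hc)
      (fun p => eq_inv_smul_iff.2 (hsnd p).symm)
  refine ⟨⟨srefl, ssymm, strans, ?_, ?_, ?_, ?_, ?_, ?_, ?_⟩, ?_, ?_⟩
  · intro x
    refine (Set.countable_range (fun g : G => g • x)).mono ?_
    rintro y ⟨g, hg⟩
    exact ⟨g, hg.symm⟩
  · exact e.t2Space
  · exact e.symm.isClosedEmbedding.locallyCompactSpace
  · letI := TopologicalSpace.metrizableSpaceMetric X
    haveI : SecondCountableTopology X := inferInstance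
    exact e.symm.secondCountableTopology
  · refine hmk (Z := ↥(CompPairs (orbitRelSet G X))) (compMap _ strans) (fun q => c q.1.2 * c q.1.1) ?_ ?_ ?_
    · have : Continuous (fun q : ↥(CompPairs (orbitRelSet G X)) => q.1.1) :=
        continuous_fst.comp continuous_subtype_val
      have h2 := hSfst.comp this
      exact h2
    · exact (continuous_of_discreteTopology (f := fun q : G × G => q.1 * q.2)).comp
        ((hc.comp (continuous_snd.comp continuous_subtype_val)).prodMk
          (hc.comp (continuous_fst.comp continuous_subtype_val)))
    · intro q
      have h1 := hsnd q.1.1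
      have h2 := hsnd q.1.2
      have h3 : q.1.1.1.2 = q.1.2.1.1 := q.2
      change q.1.2.1.2 = (c q.1.2 * c q.1.1) • q.1.1.1.1
      rw [mul_smul, ← h1, h3, ← h2]
  · exact (Homeomorph.mk ⟨invMap _ ssymm, invMap _ ssymm, fun _ => rfl, fun _ => rfl⟩
      hinvc hinvc).isHomeomorph
  · have : (fun p : ↥(orbitRelSet G X) => (p : X × X).1) = Prod.fst ∘ e.symm :=
      funext fun p => (hfst p).symm
    rw [this]
    exact isLocalHomeomorph_fst_discrete.comp e.symm.isLocalHomeomorph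
  · ext ⟨x, y⟩
    constructor
    · rintro ⟨h1, g, hg⟩
      dsimp only at hg
      subst hg
      by_cases h : g = 1
      · subst h
        exact (one_smul G x).symm
      · exact absurd h1 (hfree g x h)
    · intro h
      have h : x = y := h
      subst h
      exact ⟨hR.refl x, srefl x⟩
  · let F : Fib R (orbitRelSet G X) → Fib (orbitRelSet G X) R := fun q =>
      ⟨(⟨(q.1.1.1.1, c q.1.2 • q.1.1.1.1), ⟨c q.1.2, rfl⟩⟩,
        ⟨(c q.1.2 • q.1.1.1.1, c q.1.2 • q.1.1.1.2), (hinv (c q.1.2) _ _).mp q.1.1.2⟩), rfl⟩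
    let K : Fib (orbitRelSet G X) R → Fib R (orbitRelSet G X) := fun q =>
      ⟨(⟨((c q.1.1)⁻¹ • q.1.2.1.1, (c q.1.1)⁻¹ • q.1.2.1.2),
          (hinv (c q.1.1)⁻¹ _ _).mp q.1.2.2⟩,
        ⟨((c q.1.1)⁻¹ • q.1.2.1.2, q.1.2.1.2), ⟨c q.1.1, (smul_inv_smul _ _).symm⟩⟩), rfl⟩
    have cF : ∀ q, c (F q).1.1 = c q.1.2 := fun q => cuniq _ _ rfl
    have cK : ∀ q, c (K q).1.2 = c q.1.1 := fun q => cuniq _ _ (smul_inv_smul _ _).symm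
    have hS2 : ∀ q : Fib R (orbitRelSet G X), q.1.2.1.2 = c q.1.2 • q.1.1.1.2 := by
      intro q
      rw [hsnd q.1.2, q.2]
    have hS1 : ∀ q : Fib (orbitRelSet G X) R, (c q.1.1)⁻¹ • q.1.2.1.1 = q.1.1.1.1 := by
      intro q
      rw [← q.2, hsnd q.1.1, inv_smul_smul]
    have hKF : ∀ q, K (F q) = q := by
      intro q
      apply Subtype.ext
      refine Prod.ext (Subtype.ext (Prod.ext ?_ ?_)) (Subtype.ext (Prod.ext ?_ ?_))
      · change (c (F q).1.1)⁻¹ • (c q.1.2 • q.1.1.1.1) = q.1.1.1.1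
        rw [cF, inv_smul_smul]
      · change (c (F q).1.1)⁻¹ • (c q.1.2 • q.1.1.1.2) = q.1.1.1.2
        rw [cF, inv_smul_smul]
      · change (c (F q).1.1)⁻¹ • (c q.1.2 • q.1.1.1.2) = q.1.2.1.1
        rw [cF, inv_smul_smul, q.2]
      · exact (hS2 q).symm
    have hFK : ∀ q, F (K q) = q := by
      intro q
      apply Subtype.ext
      refine Prod.ext (Subtype.ext (Prod.ext ?_ ?_)) (Subtype.ext (Prod.ext ?_ ?_))
      · exact hS1 q
      · change c (K q).1.2 • ((c q.1.1)⁻¹ • q.1.2.1.1) = q.1.1.1.2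
        rw [cK, smul_inv_smul, q.2]
      · change c (K q).1.2 • ((c q.1.1)⁻¹ • q.1.2.1.1) = q.1.2.1.1
        rw [cK, smul_inv_smul]
      · change c (K q).1.2 • ((c q.1.1)⁻¹ • q.1.2.1.2) = q.1.2.1.2
        rw [cK, smul_inv_smul]
    have p1 : Continuous (fun q : Fib R (orbitRelSet G X) => q.1.1) :=
      continuous_fst.comp continuous_subtype_val
    have p2 : Continuous (fun q : Fib R (orbitRelSet G X) => q.1.2) :=
      continuous_snd.comp continuous_subtype_val
    have r1 : Continuous (fun q : Fib (orbitRelSet G X) R => q.1.1) :=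
      continuous_fst.comp continuous_subtype_val
    have r2 : Continuous (fun q : Fib (orbitRelSet G X) R => q.1.2) :=
      continuous_snd.comp continuous_subtype_val
    have hci : Continuous (fun q : Fib (orbitRelSet G X) R => (c q.1.1)⁻¹) :=
      (continuous_of_discreteTopology (f := fun g : G => g⁻¹)).comp (hc.comp r1)
    have hF : Continuous F := by
      refine Continuous.subtype_mk (Continuous.prodMk ?_ ?_) _
      · exact hmk _ (fun q : Fib R (orbitRelSet G X) => c q.1.2) (hRfst.comp p1) (hc.comp p2)
          (fun q => rfl)
      · exact hactR.comp (p1.prodMk (hc.comp p2))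
    have hK : Continuous K := by
      refine Continuous.subtype_mk (Continuous.prodMk ?_ ?_) _
      · exact hactR.comp (r2.prodMk hci)
      · exact hmk _ (fun q : Fib (orbitRelSet G X) R => c q.1.1)
          (hact.comp ((hRsnd.comp r2).prodMk hci)) (hc.comp r1)
          (fun q => (smul_inv_smul _ _).symm)
    refine ⟨F, (Homeomorph.mk ⟨F, K, hKF, hFK⟩ hF hK).isHomeomorph, fun q => rfl,
      fun q => (hS2 q).symm, ?_⟩
    intro q g hg
    have hcg : c q.1.2 = g := cuniq _ _ hg
    subst hcg
    exact ⟨rfl, rfl⟩
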